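/- Let G be a finite group, let g ∈ G be a non-identity element, and let χ be a non-trivial irreducible character of G such that χ(x) = 0 for every x ∈ G not lying in {1} ∪ g^G, and χ(g) ≠ 0. Let N := {1} ∪ g^G (which is a normal subgroup of G). Then |G : N| = |G| − χ(1)², the index |G : N| equals the sum of ψ(1)² over all irreducible characters ψ of G with ψ ≠ χ, and |N| = 1 + χ(1)²/|G : N|. -/

import Mathlib

open CategoryTheory

/-- `χ : G → ℂ` is the character of an irreducible (simple) finite-dimensional complex
representation of the group `G`. -/
def IsIrrChar (G : Type) [Group G] (χ : G → ℂ) : Prop :=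
  ∃ V : FDRep ℂ G, Simple V ∧ FDRep.character V = χ

namespace IsIrrChar

variable {G : Type} [Group G]

theorem apply_eq_of_isConj {χ : G → ℂ} (hχ : IsIrrChar G χ) {x y : G} (h : IsConj x y) :
    χ y = χ x := by
  obtain ⟨V, -, rfl⟩ := hχ
  obtain ⟨c, rfl⟩ := isConj_iff.mp h
  exact V.char_conj x c

variable [Fintype G]

open scoped Classical in
/-- The first orthogonality relation for irreducible characters. -/
theorem sum_mul_inv {χ ψ : G → ℂ} (hχ : IsIrrChar G χ) (hψ : IsIrrChar G ψ) :
    ∑ x, χ x * ψ x⁻¹ = if χ = ψ then (Nat.card G : ℂ) else 0 := by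
  obtain ⟨V, hV, rfl⟩ := hχ
  obtain ⟨W, hW, rfl⟩ := hψ
  have hG : (Nat.card G : ℂ) ≠ 0 := NeZero.ne _
  have := invertibleOfNonzero hG
  split_ifs with h
  · rw [← h]
    exact (FDRep.simple_iff_char_is_norm_one V).mp hV
  · have key := FDRep.char_orthonormal V W
    rw [if_neg fun ⟨i⟩ => h (FDRep.char_iso i)] at key
    exact (mul_eq_zero.mp key).resolve_left (inv_ne_zero hG)

theorem apply_one_ne_zero {χ : G → ℂ} (hχ : IsIrrChar G χ) : χ 1 ≠ 0 := by
  have key := hχ.sum_mul_inv hχ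
  rw [if_pos rfl] at key
  obtain ⟨V, hV, rfl⟩ := hχ
  intro h0
  rw [FDRep.char_one, Nat.cast_eq_zero] at h0
  have : Subsingleton V := Module.finrank_zero_iff.mp h0
  have hz : ∀ x, V.character x = 0 := fun x => by
    rw [FDRep.character, Subsingleton.elim (V.ρ x) 0, map_zero]
  simp only [hz, zero_mul, Finset.sum_const_zero] at key
  exact NeZero.ne (Nat.card G : ℂ) key.symm

theorem of_isIrreducible {V : Type} [AddCommGroup V] [Module ℂ V] [FiniteDimensional ℂ V]
    (ρ : Representation ℂ G V) [ρ.IsIrreducible] : IsIrrChar G ρ.character := by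
  refine ⟨FDRep.of ρ, ?_, rfl⟩
  have hG : (Nat.card G : ℂ) ≠ 0 := NeZero.ne _
  have := invertibleOfNonzero hG
  have key := Representation.card_inv_mul_sum_char_mul_char_eq_finrank ρ ρ
  rw [Representation.IsIrreducible.finrank_intertwiningMap_self, Nat.cast_one,
    inv_mul_eq_one₀ hG] at key
  exact (FDRep.simple_iff_char_is_norm_one _).mpr key.symm

theorem one : IsIrrChar G fun _ => 1 := by
  have h : (FDRep.of (Representation.trivial ℂ G ℂ)).character = fun _ => 1 := by
    ext x
    exact (LinearMap.trace_id ℂ ℂ).trans (by simp)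
  exact ⟨_, (FDRep.simple_iff_char_is_norm_one _).mpr (by simp [h]), h⟩

end IsIrrChar

namespace Representation

variable {G : Type} [Group G]

theorem character_eq_add_of_isCompl {k V : Type*} [Field k] [AddCommGroup V] [Module k V]
    [FiniteDimensional k V] (ρ : Representation k G V) {a b : Subrepresentation ρ}
    (h : IsCompl a.toSubmodule b.toSubmodule) :
    ρ.character = a.toRepresentation.character + b.toRepresentation.character := by
  ext x
  simp only [character, Pi.add_apply]
  rw [← LinearMap.trace_prodMap', ← LinearMap.trace_conj' _ (Submodule.prodEquivOfIsCompl _ _ h)]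
  congr 1
  ext v
  obtain ⟨w, rfl⟩ := (Submodule.prodEquivOfIsCompl _ _ h).surjective v
  simp [LinearEquiv.conj_apply, Subrepresentation.toRepresentation]

/-- Every character of a finite group is a sum of irreducible characters. -/
theorem exists_character_eq_sum_isIrrChar [Fintype G] {V : Type} [AddCommGroup V] [Module ℂ V]
    [FiniteDimensional ℂ V] (ρ : Representation ℂ G V) :
    ∃ s : Multiset (G → ℂ), (∀ ψ ∈ s, IsIrrChar G ψ) ∧ ρ.character = s.sum := by
  induction hn : Module.finrank ℂ V using Nat.strong_induction_on generalizing V with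
  | _ n ih =>
  by_cases hV : Subsingleton V
  · refine ⟨0, by simp, ?_⟩
    ext x
    rw [character, Subsingleton.elim (ρ x) 0]
    simp
  by_cases hirr : ρ.IsIrreducible
  · exact ⟨{ρ.character}, by simpa using IsIrrChar.of_isIrreducible ρ, by simp⟩
  have hnt : Nontrivial (Subrepresentation ρ) := by
    refine ⟨⊥, ⊤, fun h => hV ?_⟩
    have h' := congrArg Subrepresentation.toSubmodule h
    exact (Submodule.subsingleton_iff ℂ).mp (subsingleton_of_bot_eq_top h')
  obtain ⟨a, ha⟩ : ∃ a : Subrepresentation ρ, ¬(a = ⊥ ∨ a = ⊤) := by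
    by_contra! h
    exact hirr ⟨h⟩
  rw [not_or] at ha
  obtain ⟨b, hab⟩ := exists_isCompl a
  have hc : IsCompl a.toSubmodule b.toSubmodule := by
    refine IsCompl.of_eq ?_ ?_
    · exact congrArg Subrepresentation.toSubmodule hab.inf_eq_bot
    · exact congrArg Subrepresentation.toSubmodule hab.sup_eq_top
  have hsum := Submodule.finrank_add_eq_of_isCompl hc
  have ha0 : Module.finrank ℂ a.toSubmodule ≠ 0 := fun h =>
    ha.1 (Subrepresentation.toSubmodule_injective (Submodule.finrank_eq_zero.mp h))
  have ha1 : Module.finrank ℂ a.toSubmodule ≠ Module.finrank ℂ V := fun h =>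
    ha.2 (Subrepresentation.toSubmodule_injective (Submodule.eq_top_of_finrank_eq h))
  obtain ⟨s, hs, hs'⟩ := ih _ (by omega) a.toRepresentation rfl
  obtain ⟨t, ht, ht'⟩ := ih _ (by omega) b.toRepresentation rfl
  refine ⟨s + t, fun ψ hψ => (Multiset.mem_add.mp hψ).elim (hs ψ) (ht ψ), ?_⟩
  rw [character_eq_add_of_isCompl ρ hc, hs', ht', Multiset.sum_add]

theorem character_leftRegular_of_ne_one [Fintype G] {k : Type*} [Field k] {x : G} (hx : x ≠ 1) :
    (leftRegular k G).character x = 0 := by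
  classical
  rw [character, LinearMap.trace_eq_matrix_trace k (MonoidAlgebra.basis G k), Matrix.trace]
  refine Finset.sum_eq_zero fun h _ => ?_
  rw [Matrix.diag_apply, LinearMap.toMatrix_apply, MonoidAlgebra.basis_apply, ofMulAction_single]
  change Finsupp.single (x • h) (1 : k) h = 0
  simp [hx]

end Representation

open scoped Classical in
/-- The squares of the degrees of the irreducible characters sum to the order of the group. -/
theorem IsIrrChar.exists_finset_sum_sq (G : Type) [Group G] [Fintype G] :
    ∃ s : Finset (G → ℂ), (∀ ψ, ψ ∈ s ↔ IsIrrChar G ψ) ∧ ∑ ψ ∈ s, ψ 1 ^ 2 = (Nat.card G : ℂ) := by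
  obtain ⟨s, hs, hsum⟩ :=
    (Representation.leftRegular ℂ G).exists_character_eq_sum_isIrrChar
  have hone : (Representation.leftRegular ℂ G).character 1 = Nat.card G := by
    rw [Representation.char_one, Module.finrank_eq_nat_card_basis (MonoidAlgebra.basis G ℂ)]
  have happ : ∀ x, (Representation.leftRegular ℂ G).character x =
      ∑ φ ∈ s.toFinset, s.count φ * φ x := fun x => by
    rw [hsum, Finset.sum_multiset_count]
    simp
  have hcount : ∀ ψ, IsIrrChar G ψ → (s.count ψ : ℂ) = ψ 1 := by
    intro ψ hψ
    have h1 : ∑ x, (Representation.leftRegular ℂ G).character x * ψ x⁻¹ = Nat.card G * ψ 1 := by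
      rw [Finset.sum_eq_single 1]
      · rw [hone, inv_one]
      · intro x _ hx
        rw [Representation.character_leftRegular_of_ne_one hx, zero_mul]
      · simp
    have h2 : ∑ x, (Representation.leftRegular ℂ G).character x * ψ x⁻¹ =
        Nat.card G * s.count ψ := by
      simp only [happ, Finset.sum_mul, mul_assoc]
      rw [Finset.sum_comm]
      simp only [← Finset.mul_sum]
      rw [Finset.sum_congr rfl fun φ hφ => by
        rw [(hs φ (Multiset.mem_toFinset.mp hφ)).sum_mul_inv hψ]]
      by_cases hm : ψ ∈ s
      · simp [hm, mul_comm]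
      · simp [hm]
    exact mul_left_cancel₀ (NeZero.ne (Nat.card G : ℂ)) (h2.symm.trans h1)
  refine ⟨s.toFinset, fun ψ => ⟨fun h => hs ψ (Multiset.mem_toFinset.mp h), fun h => ?_⟩, ?_⟩
  · rw [Multiset.mem_toFinset, ← Multiset.count_ne_zero, ← Nat.cast_ne_zero (R := ℂ), hcount ψ h]
    exact h.apply_one_ne_zero
  · rw [← hone, happ]
    refine Finset.sum_congr rfl fun ψ hψ => ?_
    rw [hcount ψ (hs ψ (Multiset.mem_toFinset.mp hψ)), sq]

/-- In the situation of a non-trivial irreducible character `χ` vanishing outside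
`{1} ∪ g^G` with `χ(g) ≠ 0`, for the normal subgroup `N = {1} ∪ g^G` one has
`|G : N| = |G| - χ(1)²`, `|G : N| = ∑_{ψ ≠ χ} ψ(1)²`, and `|N| = 1 + χ(1)²/|G : N|`. -/
theorem vanishing_off_one_class_index (G : Type) [Group G] [Finite G] (g : G) (hg : g ≠ 1)
    (χ : G → ℂ) (hχ : IsIrrChar G χ) (hne : χ ≠ fun _ => 1)
    (hvan : ∀ x : G, x ∉ ({1} ∪ {y | IsConj g y} : Set G) → χ x = 0)
    (hgval : χ g ≠ 0)
    (N : Subgroup G) (hN : (N : Set G) = ({1} ∪ {y | IsConj g y} : Set G))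
    (hNnormal : N.Normal) :
    (N.index : ℂ) = (Nat.card G : ℂ) - (χ 1) ^ 2 ∧
    (N.index : ℂ) = ∑ᶠ ψ ∈ {ψ : G → ℂ | IsIrrChar G ψ ∧ ψ ≠ χ}, (ψ 1) ^ 2 ∧
    (Nat.card N : ℂ) = 1 + (χ 1) ^ 2 / (N.index : ℂ) := by
  classical
  have := Fintype.ofFinite G
  have hmem : ∀ x, x ∈ N ↔ x = 1 ∨ IsConj g x := fun x => by
    rw [← SetLike.mem_coe, hN]; rfl
  have hconst : ∀ x ∈ N, x ≠ 1 → χ x = χ g := fun x hx hx1 =>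
    hχ.apply_eq_of_isConj (((hmem x).mp hx).resolve_left hx1)
  have hsupp : ∀ f : G → ℂ, (∀ x ∉ N, f x = 0) → (∀ x ∈ N, x ≠ 1 → f x = f g) →
      ∑ x, f x = f 1 + (Nat.card N - 1) * f g := by
    intro f hf hf'
    have : ∀ x, f x = (if x = 1 then f 1 - f g else 0) + if x ∈ N then f g else 0 := by
      intro x
      by_cases h1 : x = 1
      · simp [h1, N.one_mem]
      · by_cases hx : x ∈ N
        · simp [h1, hx, hf' x hx h1]
        · simp [h1, hx, hf x hx]
    rw [Finset.sum_congr rfl fun x _ => this x, Finset.sum_add_distrib, Finset.sum_ite_eq',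
      if_pos (Finset.mem_univ _), ← Finset.sum_filter, Finset.sum_const, nsmul_eq_mul,
      ← Fintype.card_subtype, ← Nat.card_eq_fintype_card]
    change _ + (Nat.card N : ℂ) * _ = _
    ring
  have hvan' : ∀ x ∉ N, χ x = 0 := fun x hx => hvan x (hN ▸ hx)
  have hgN : g ∈ N := (hmem g).mpr (Or.inr (IsConj.refl g))
  have horth : χ 1 + (Nat.card N - 1) * χ g = 0 := by
    rw [← hsupp χ hvan' hconst]
    simpa [hne] using hχ.sum_mul_inv IsIrrChar.one
  have hnorm : χ 1 ^ 2 + (Nat.card N - 1) * χ g ^ 2 = Nat.card G := by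
    have hinv : ∀ x ∈ N, x ≠ 1 → χ x⁻¹ = χ g := fun x hx hx1 =>
      hconst _ (N.inv_mem hx) (inv_ne_one.mpr hx1)
    have h := hχ.sum_mul_inv hχ
    rw [if_pos rfl, hsupp _ (fun x hx => by simp [hvan' x hx])
      (fun x hx hx1 => by rw [hconst x hx hx1, hinv x hx hx1, hinv g hgN hg]), hinv g hgN hg,
      inv_one] at h
    rw [← h]
    ring
  have hcard : (Nat.card N : ℂ) * N.index = Nat.card G := by
    exact_mod_cast N.card_mul_index
  have hidx : (N.index : ℂ) ≠ 0 := Nat.cast_ne_zero.mpr N.index_ne_zero_of_finite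
  have hNne : (Nat.card N : ℂ) ≠ 0 := NeZero.ne _
  have hfirst : (N.index : ℂ) = Nat.card G - χ 1 ^ 2 := by
    have h1 : χ 1 = -((Nat.card N - 1) * χ g) := eq_neg_of_add_eq_zero_left horth
    rw [h1] at hnorm ⊢
    apply mul_left_cancel₀ hNne
    rw [hcard]
    linear_combination ((Nat.card N : ℂ) - 1) * hnorm
  refine ⟨hfirst, ?_, ?_⟩
  · obtain ⟨s, hs, hsum⟩ := IsIrrChar.exists_finset_sum_sq G
    have hset : {ψ : G → ℂ | IsIrrChar G ψ ∧ ψ ≠ χ} = ↑(s.erase χ) := by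
      ext ψ
      simp [hs]
    rw [hset, finsum_mem_coe_finset, Finset.sum_erase_eq_sub ((hs χ).mpr hχ), hsum, hfirst]
  · field_simp
    rw [hcard]
    linear_combination -hfirst
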